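/- arXiv:2301.06917 — 10 statements merged into one kernel-verified Lean document; each statement's English description precedes it below -/
import Mathlib

section
/- Let (A,·) be an anti-pre-Lie algebra over a field k and (V,ρ,μ) a representation of (A,·). Then (V, ρ−μ) is a representation of the sub-adjacent Lie algebra (A,[·,·]), i.e. (ρ−μ)([x,y]) = (ρ−μ)(x)∘(ρ−μ)(y) − (ρ−μ)(y)∘(ρ−μ)(x) for all x,y ∈ A. -/
/-- An anti-pre-Lie algebra structure: a bilinear multiplication `mul` on `A` satisfying
`x·(y·z) − y·(x·z) = [y,x]·z` and `[x,y]·z + [y,z]·x + [z,x]·y = 0`,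
where `[x,y] = x·y − y·x`. -/
def IsAntiPreLie (k : Type*) {A : Type*} [Field k] [AddCommGroup A] [Module k A]
    (mul : A →ₗ[k] A →ₗ[k] A) : Prop :=
  (∀ x y z : A, mul x (mul y z) - mul y (mul x z) = mul (mul y x - mul x y) z) ∧
  (∀ x y z : A,
    mul (mul x y - mul y x) z + mul (mul y z - mul z y) x + mul (mul z x - mul x z) y = 0)

/-- A representation `(V, ρ, μ)` of an anti-pre-Lie algebra `(A, mul)`. -/
def IsAntiPreLieRep (k : Type*) {A : Type*} (V : Type*) [Field k] [AddCommGroup A]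
    [Module k A] [AddCommGroup V] [Module k V] (mul : A →ₗ[k] A →ₗ[k] A)
    (ρ μ : A →ₗ[k] Module.End k V) : Prop :=
  (∀ x y : A, ρ x * ρ y - ρ y * ρ x = ρ (mul y x - mul x y)) ∧
  (∀ x y : A, μ (mul x y) - ρ x * μ y = μ y * ρ x - μ y * μ x) ∧
  (∀ x y : A, μ y * μ x - μ x * μ y + ρ (mul x y - mul y x) = μ y * ρ x - μ x * ρ y)

/-- An anti-L-dendriform algebra structure: two bilinear products `tr` (`▷`) and `tl` (`◁`). -/
def IsAntiLDendriform (k : Type*) {A : Type*} [Field k] [AddCommGroup A] [Module k A]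
    (tr tl : A →ₗ[k] A →ₗ[k] A) : Prop :=
  (∀ x y z : A, tr x (tr y z) - tr y (tr x z) - tr (tr y x) z + tr (tl x y) z
      + tr (tr x y) z - tr (tl y x) z = 0) ∧
  (∀ x y z : A, tr x (tl y z) - tl (tr x y) z + tl (tl y x) z + tl y (tl x z)
      + tl y (tr x z) = 0) ∧
  (∀ x y z : A, tl y (tl x z) + tl y (tr x z) + tr (tr x y) z - tr (tl y x) z
      - tr (tr y x) z + tr (tl x y) z - tl x (tr y z) - tl x (tl y z) = 0)

/-- `(V, ρ - μ)` is a representation of the sub-adjacent Lie algebra. -/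
theorem stmt_3 {k A V : Type*} [Field k] [AddCommGroup A] [Module k A]
    [AddCommGroup V] [Module k V]
    (mul : A →ₗ[k] A →ₗ[k] A) (hA : IsAntiPreLie k mul)
    (ρ μ : A →ₗ[k] Module.End k V) (hrep : IsAntiPreLieRep k V mul ρ μ) :
    ∀ x y : A,
      ρ (mul x y - mul y x) - μ (mul x y - mul y x) =
        (ρ x - μ x) * (ρ y - μ y) - (ρ y - μ y) * (ρ x - μ x) := by
  intro x y
  obtain ⟨hρ, hμ, hρμ⟩ := hrep
  have hcomm := hρ x y
  have hxy := hμ x y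
  have hyx := hμ y x
  have hmixed := hρμ x y
  simp only [map_sub] at hcomm hmixed
  simp only [map_sub, mul_sub, sub_mul]
  linear_combination (norm := module) (2 : k) • hmixed - hcomm - hxy + hyx
end

section
/- Let (A,·) be an anti-pre-Lie algebra over a field k and (V,ρ,μ) a representation of (A,·). Let ρ*, μ* : A → gl(V*) be defined by ⟨ρ*(x)(ξ), u⟩ = −⟨ξ, ρ(x)(u)⟩ and ⟨μ*(x)(ξ), u⟩ = −⟨ξ, μ(x)(u)⟩ for x ∈ A, ξ ∈ V*, u ∈ V. Then (V*, μ*−ρ*, μ*) is a representation of (A,·) (the dual representation). -/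
set_option synthInstance.maxHeartbeats 1000000
set_option maxSynthPendingDepth 3
set_option maxHeartbeats 1000000

/-- The dual representation `(V*, μ* - ρ*, μ*)` of a representation of an
anti-pre-Lie algebra is again a representation. -/
theorem stmt_4 {k A V : Type*} [Field k] [AddCommGroup A] [Module k A]
    [AddCommGroup V] [Module k V]
    (mul : A →ₗ[k] A →ₗ[k] A) (hA : IsAntiPreLie k mul)
    (ρ μ : A →ₗ[k] Module.End k V) (hrep : IsAntiPreLieRep k V mul ρ μ)
    (ρs μs : A →ₗ[k] Module.End k (Module.Dual k V))
    (hρs : ∀ (x : A) (ξ : Module.Dual k V) (u : V), ρs x ξ u = - ξ (ρ x u))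
    (hμs : ∀ (x : A) (ξ : Module.Dual k V) (u : V), μs x ξ u = - ξ (μ x u)) :
    IsAntiPreLieRep k (Module.Dual k V) mul (μs - ρs) μs := by
  obtain ⟨h1, h2, h3⟩ := hrep
  have e1 (x y : A) (ξ : Module.Dual k V) (u : V) := congrArg (fun T => ξ (T u)) (h1 x y)
  have e2 (x y : A) (ξ : Module.Dual k V) (u : V) := congrArg (fun T => ξ (T u)) (h2 x y)
  have e3 (x y : A) (ξ : Module.Dual k V) (u : V) := congrArg (fun T => ξ (T u)) (h3 x y)
  simp only [map_sub, map_add, LinearMap.sub_apply, LinearMap.add_apply,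
    Module.End.mul_apply] at e1 e2 e3
  refine ⟨fun x y => ?_, fun x y => ?_, fun x y => ?_⟩ <;> ext ξ u <;>
    simp only [map_sub, LinearMap.sub_apply, LinearMap.add_apply,
      Module.End.mul_apply, hρs, hμs]
  · linear_combination -e1 x y ξ u - e2 x y ξ u + e2 y x ξ u + 2 * e3 x y ξ u
  · linear_combination -e2 x y ξ u
  · linear_combination -e2 x y ξ u + e2 y x ξ u + e3 x y ξ u
end

section
/- Let (A,·) be an anti-pre-Lie algebra over a field k. Let L, R : A → gl(A) be defined by L(x)(y) = x·y and R(x)(y) = y·x, and let L*, R* : A → gl(A*) be defined by ⟨L*(x)(ξ), y⟩ = −⟨ξ, L(x)(y)⟩ and ⟨R*(x)(ξ), y⟩ = −⟨ξ, R(x)(y)⟩. Then (A*, R*−L*, R*) is a representation of (A,·). -/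
set_option synthInstance.maxHeartbeats 1000000
set_option maxSynthPendingDepth 3
set_option maxHeartbeats 1000000

/-- `(A*, R* - L*, R*)` is a representation of the anti-pre-Lie algebra `(A, ·)`. -/
theorem stmt_6 {k A : Type*} [Field k] [AddCommGroup A] [Module k A]
    (mul : A →ₗ[k] A →ₗ[k] A) (hA : IsAntiPreLie k mul)
    (Ls Rs : A →ₗ[k] Module.End k (Module.Dual k A))
    (hLs : ∀ (x : A) (ξ : Module.Dual k A) (y : A), Ls x ξ y = - ξ (mul x y))
    (hRs : ∀ (x : A) (ξ : Module.Dual k A) (y : A), Rs x ξ y = - ξ (mul y x)) :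
    IsAntiPreLieRep k (Module.Dual k A) mul (Rs - Ls) Rs := by
  obtain ⟨h₁, h₂⟩ := hA
  refine ⟨fun x y => ?_, fun x y => ?_, fun x y => ?_⟩ <;> ext ξ z
  · have hxy := congrArg ξ (h₁ x y z)
    have hyz := congrArg ξ (h₁ y z x)
    have hzx := congrArg ξ (h₁ z x y)
    have hcyc := congrArg ξ (h₂ x y z)
    simp only [map_sub, map_add, map_zero, LinearMap.sub_apply,
      Module.End.mul_apply, hLs, hRs] at hxy hyz hzx hcyc ⊢
    linear_combination -hxy - hyz - hzx + 2 * hcyc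
  · have hxz := congrArg ξ (h₁ x z y)
    simp only [map_sub, LinearMap.sub_apply, Module.End.mul_apply, hLs, hRs] at hxz ⊢
    linear_combination hxz
  · have hxz := congrArg ξ (h₁ x z y)
    have hzy := congrArg ξ (h₁ z y x)
    have hcyc := congrArg ξ (h₂ x y z)
    simp only [map_sub, map_add, map_zero, LinearMap.sub_apply, LinearMap.add_apply,
      Module.End.mul_apply, hLs, hRs] at hxz hzy hcyc ⊢
    linear_combination hxz + hzy + hcyc
end

section
/- Let (A,·) be an anti-pre-Lie algebra over a field k and (V,ρ,μ) a representation of (A,·). Then for every linear map f : A → V, the 2-cochain d¹f is a 2-cocycle; that is, d²₁(d¹f)(x,y,z) = 0 and d²₂(d¹f)(x,y,z) = 0 for all x,y,z ∈ A. In particular B²(A;V) ⊆ Z²(A;V). -/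
/-- For every linear map `f : A → V`, the 2-cochain `d¹f` is a 2-cocycle:
`d²₁(d¹f) = 0` and `d²₂(d¹f) = 0`. In particular `B²(A;V) ⊆ Z²(A;V)`. -/
theorem stmt_9 {k A V : Type*} [Field k] [AddCommGroup A] [Module k A]
    [AddCommGroup V] [Module k V]
    (mul : A →ₗ[k] A →ₗ[k] A) (hA : IsAntiPreLie k mul)
    (ρ μ : A →ₗ[k] Module.End k V) (hrep : IsAntiPreLieRep k V mul ρ μ)
    (f : A →ₗ[k] V) (g : A → A → V)
    (hg : ∀ x y : A, g x y = ρ x (f y) + μ y (f x) - f (mul x y)) :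
    (∀ x y z : A,
      ρ x (g y z) - ρ y (g x z) - μ z (g y x) + μ z (g x y)
        - g y (mul x z) + g x (mul y z) + g (mul x y - mul y x) z = 0) ∧
    (∀ x y z : A,
      μ x (g y z - g z y) + μ y (g z x - g x z) + μ z (g x y - g y x)
        + g (mul x y - mul y x) z + g (mul y z - mul z y) x
        + g (mul z x - mul x z) y = 0) := by
  obtain ⟨hmul, hcyc⟩ := hA
  obtain ⟨hρ, hρμ, hμ⟩ := hrep
  have hρ' (x y : A) (v : V) := LinearMap.congr_fun (hρ x y) v
  have hρμ' (x y : A) (v : V) := LinearMap.congr_fun (hρμ x y) v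
  have hμ' (x y : A) (v : V) := LinearMap.congr_fun (hμ x y) v
  simp only [LinearMap.sub_apply, LinearMap.add_apply, Module.End.mul_apply, map_sub]
    at hρ' hρμ' hμ'
  refine ⟨fun x y z => ?_, fun x y z => ?_⟩
  · have hf := congrArg f (hmul x y z)
    simp only [hg, map_add, map_sub, LinearMap.sub_apply] at hf ⊢
    linear_combination (norm := module) hρ' x y (f z) - hρμ' x z (f y) + hρμ' y z (f x) - hf
  · have hf := congrArg f (hcyc x y z)
    simp only [hg, map_add, map_sub, map_zero, LinearMap.sub_apply] at hf ⊢
    linear_combination (norm := module) hμ' x y (f z) + hμ' y z (f x) + hμ' z x (f y) - hf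
end

section
/- Let (A,▷,◁) be an anti-L-dendriform algebra over a field k. Then the bilinear operation x·y = x▷y − y◁x makes (A,·) an anti-pre-Lie algebra, i.e. it satisfies x·(y·z) − y·(x·z) = [y,x]·z and [x,y]·z + [y,z]·x + [z,x]·y = 0 for all x,y,z ∈ A, where [x,y] = x·y − y·x. -/
/-- The product `x·y = x▷y - y◁x` of an anti-L-dendriform algebra is anti-pre-Lie. -/
theorem stmt_10 {k A : Type*} [Field k] [AddCommGroup A] [Module k A]
    (tr tl : A →ₗ[k] A →ₗ[k] A) (hD : IsAntiLDendriform k tr tl) :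
    IsAntiPreLie k (tr - LinearMap.flip tl) := by
  obtain ⟨h₁, h₂, h₃⟩ := hD
  constructor
  · intro x y z
    have key := congrArg₂ (· + ·) (h₁ x y z) (congrArg₂ (· - ·) (h₂ y z x) (h₂ x z y))
    simp only [LinearMap.sub_apply, LinearMap.flip_apply, map_sub, sub_zero, add_zero] at key ⊢
    rw [← sub_eq_zero, ← key]
    abel
  · intro x y z
    have key := congrArg₂ (· + ·) (h₃ x y z) (congrArg₂ (· + ·) (h₃ y z x) (h₃ z x y))
    simp only [LinearMap.sub_apply, LinearMap.flip_apply, map_sub, add_zero] at key ⊢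
    rw [← key]
    abel
end

section
/- Let A be a vector space over a field k with two bilinear products ▷, ◁ : A × A → A, and define x·y = x▷y − y◁x. Then (A,▷,◁) is an anti-L-dendriform algebra if and only if (A,·) is an anti-pre-Lie algebra and (A, L▷, −L◁) is a representation of (A,·), where L▷(x)(y) = x▷y and L◁(x)(y) = x◁y. -/
/-- `(A, ▷, ◁)` is anti-L-dendriform iff `x·y = x▷y - y◁x` is anti-pre-Lie and
`(A, L▷, -L◁)` is a representation of `(A, ·)`. -/
theorem stmt_11 {k A : Type*} [Field k] [AddCommGroup A] [Module k A]
    (tr tl : A →ₗ[k] A →ₗ[k] A) :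
    IsAntiLDendriform k tr tl ↔
      (IsAntiPreLie k (tr - LinearMap.flip tl) ∧
        IsAntiPreLieRep k A (tr - LinearMap.flip tl) tr (-tl)) := by
  simp only [IsAntiLDendriform, IsAntiPreLie, IsAntiPreLieRep, LinearMap.ext_iff,
    LinearMap.flip_apply, LinearMap.sub_apply, LinearMap.add_apply, LinearMap.neg_apply,
    Module.End.mul_apply, map_sub, map_neg]
  constructor
  · rintro ⟨h₁, h₂, h₃⟩
    refine ⟨⟨fun x y z => ?_, fun x y z => ?_⟩, fun x y z => ?_, fun x y z => ?_,
      fun x y z => ?_⟩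
    · linear_combination (norm := abel) h₁ x y z - h₂ x z y + h₂ y z x
    · linear_combination (norm := abel) h₃ x y z + h₃ y z x + h₃ z x y
    · linear_combination (norm := abel) h₁ x y z
    · linear_combination (norm := abel) h₂ x y z
    · linear_combination (norm := abel) h₃ x y z
  · rintro ⟨-, h₁, h₂, h₃⟩
    refine ⟨fun x y z => ?_, fun x y z => ?_, fun x y z => ?_⟩
    · linear_combination (norm := abel) h₁ x y z
    · linear_combination (norm := abel) h₂ x y z
    · linear_combination (norm := abel) h₃ x y z
end

section
/- Let (A,▷,◁) be an anti-L-dendriform algebra over a field k with associated anti-pre-Lie product x·y = x▷y − y◁x. Let L▷, L◁ : A → gl(A) be given by L▷(x)(y) = x▷y, L◁(x)(y) = x◁y, and for a linear map F : A → gl(A) let F* : A → gl(A*) be given by ⟨F*(x)(ξ), y⟩ = −⟨ξ, F(x)(y)⟩. Then (A*, −L◁* − L▷*, −L◁*) is a representation of the anti-pre-Lie algebra (A,·). -/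
set_option synthInstance.maxHeartbeats 1000000
set_option maxSynthPendingDepth 3
set_option maxHeartbeats 1000000

/-- For an anti-L-dendriform algebra, `(A*, -L◁* - L▷*, -L◁*)` is a representation
of the associated anti-pre-Lie algebra. -/
theorem stmt_12 {k A : Type*} [Field k] [AddCommGroup A] [Module k A]
    (tr tl : A →ₗ[k] A →ₗ[k] A) (hD : IsAntiLDendriform k tr tl)
    (trS tlS : A →ₗ[k] Module.End k (Module.Dual k A))
    (htrS : ∀ (x : A) (ξ : Module.Dual k A) (y : A), trS x ξ y = - ξ (tr x y))
    (htlS : ∀ (x : A) (ξ : Module.Dual k A) (y : A), tlS x ξ y = - ξ (tl x y)) :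
    IsAntiPreLieRep k (Module.Dual k A) (tr - LinearMap.flip tl) (-tlS - trS) (-tlS) := by
  obtain ⟨h₁, h₂, h₃⟩ := hD
  refine ⟨fun x y => ?_, fun x y => ?_, fun x y => ?_⟩ <;> ext ξ z
  all_goals
    have e₁ := congrArg ξ (h₁ x y z)
    have e₂ := congrArg ξ (h₂ x y z)
    have e₂' := congrArg ξ (h₂ y x z)
    have e₃ := congrArg ξ (h₃ x y z)
    simp only [map_add, map_sub, map_zero] at e₁ e₂ e₂' e₃
    simp only [LinearMap.sub_apply, LinearMap.add_apply, LinearMap.neg_apply, Module.End.mul_apply,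
      LinearMap.flip_apply, map_sub, map_neg, htrS, htlS]
  · linear_combination -e₁ - e₂ + e₂' + 2 * e₃
  · linear_combination -e₂
  · linear_combination -e₂ + e₂' + e₃
end

section
/- Let (A,·) be an anti-pre-Lie algebra over a field k, (V,ρ,μ) a representation of (A,·), and T : V → A an O-operator, i.e. a linear map with T(u)·T(v) = T(ρ(T(u))(v) + μ(T(v))(u)) for all u,v ∈ V. Then the bilinear products on V defined by u ▷ v = ρ(T(u))(v) and u ◁ v = −μ(T(u))(v) make (V,▷,◁) an anti-L-dendriform algebra. -/
/-- An O-operator `T` on an anti-pre-Lie algebra induces an anti-L-dendriform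
structure on `V` via `u ▷ v = ρ(T u)(v)` and `u ◁ v = -μ(T u)(v)`. -/
theorem stmt_13 {k A V : Type*} [Field k] [AddCommGroup A] [Module k A]
    [AddCommGroup V] [Module k V]
    (mul : A →ₗ[k] A →ₗ[k] A) (hA : IsAntiPreLie k mul)
    (ρ μ : A →ₗ[k] Module.End k V) (hrep : IsAntiPreLieRep k V mul ρ μ)
    (T : V →ₗ[k] A)
    (hT : ∀ u v : V, mul (T u) (T v) = T (ρ (T u) v + μ (T v) u)) :
    IsAntiLDendriform k (ρ ∘ₗ T) (-(μ ∘ₗ T)) := by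
  obtain ⟨hρ, hμ, hρμ⟩ := hrep
  refine ⟨fun x y z => ?_, fun x y z => ?_, fun x y z => ?_⟩
  · have h := LinearMap.congr_fun (hρ (T x) (T y)) z
    simp only [hT, map_add, map_sub, LinearMap.sub_apply, LinearMap.add_apply,
      Module.End.mul_apply] at h
    simp only [LinearMap.comp_apply, LinearMap.neg_apply, map_neg]
    rw [← sub_eq_zero] at h
    rw [← h]
    abel
  · have h := LinearMap.congr_fun (hμ (T x) (T y)) z
    simp only [hT, map_add, LinearMap.sub_apply, LinearMap.add_apply,
      Module.End.mul_apply] at h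
    simp only [LinearMap.comp_apply, LinearMap.neg_apply, map_neg]
    rw [← sub_eq_zero] at h
    rw [← h]
    abel
  · have h := LinearMap.congr_fun (hρμ (T x) (T y)) z
    simp only [hT, map_add, map_sub, LinearMap.sub_apply, LinearMap.add_apply,
      Module.End.mul_apply] at h
    simp only [LinearMap.comp_apply, LinearMap.neg_apply, map_neg]
    rw [← sub_eq_zero] at h
    rw [← h]
    abel
end

section
/- Let (A,·) be an anti-pre-Lie algebra over a field k, (V,ρ,μ) a representation of (A,·), and T : V → A an invertible (bijective) O-operator. Define bilinear products on A by x ▷ y = T(ρ(x)(T⁻¹(y))) and y ◁ x = −T(μ(y)(T⁻¹(x))). Then (A,▷,◁) is an anti-L-dendriform algebra and it is compatible with (A,·), i.e. x▷y − y◁x = x·y for all x,y ∈ A. -/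
/-- An invertible O-operator induces a compatible anti-L-dendriform structure on
`A` via `x ▷ y = T(ρ(x)(T⁻¹ y))` and `y ◁ x = -T(μ(y)(T⁻¹ x))`. -/
theorem stmt_15 {k A V : Type*} [Field k] [AddCommGroup A] [Module k A]
    [AddCommGroup V] [Module k V]
    (mul : A →ₗ[k] A →ₗ[k] A) (hA : IsAntiPreLie k mul)
    (ρ μ : A →ₗ[k] Module.End k V) (hrep : IsAntiPreLieRep k V mul ρ μ)
    (T : V ≃ₗ[k] A)
    (hT : ∀ u v : V, mul (T u) (T v) = T (ρ (T u) v + μ (T v) u))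
    (tr tl : A →ₗ[k] A →ₗ[k] A)
    (htr : ∀ x y : A, tr x y = T (ρ x (T.symm y)))
    (htl : ∀ x y : A, tl x y = - T (μ x (T.symm y))) :
    IsAntiLDendriform k tr tl ∧ ∀ x y : A, tr x y - tl y x = mul x y := by
  have hmul : ∀ x y : A, tr x y - tl y x = mul x y := fun x y => by
    have h := hT (T.symm x) (T.symm y)
    simp only [LinearEquiv.apply_symm_apply, map_add] at h
    rw [htr, htl, h, sub_neg_eq_add]
  obtain ⟨h₁, h₂, h₃⟩ := hrep
  refine ⟨⟨fun x y z => ?_, fun x y z => ?_, fun x y z => ?_⟩, hmul⟩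
  · have h := congrArg T (LinearMap.congr_fun (h₁ x y) (T.symm z))
    simp only [LinearMap.sub_apply, Module.End.mul_apply, map_sub] at h
    have hxy := congrArg (fun a => tr a z) (hmul x y)
    have hyx := congrArg (fun a => tr a z) (hmul y x)
    simp only [map_sub, LinearMap.sub_apply] at hxy hyx
    simp only [htr, LinearEquiv.symm_apply_apply] at h hxy hyx ⊢
    grind
  · have h := congrArg T (LinearMap.congr_fun (h₂ x y) (T.symm z))
    simp only [LinearMap.sub_apply, Module.End.mul_apply, map_sub] at h
    have hxy := congrArg (fun a => tl a z) (hmul x y)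
    simp only [map_sub, LinearMap.sub_apply] at hxy
    simp only [htr, htl, LinearEquiv.symm_apply_apply, map_neg] at h hxy ⊢
    grind
  · have h := congrArg T (LinearMap.congr_fun (h₃ x y) (T.symm z))
    simp only [LinearMap.sub_apply, LinearMap.add_apply, Module.End.mul_apply, map_sub,
      map_add] at h
    have hxy := congrArg (fun a => tr a z) (hmul x y)
    have hyx := congrArg (fun a => tr a z) (hmul y x)
    simp only [map_sub, LinearMap.sub_apply] at hxy hyx
    simp only [htr, htl, LinearEquiv.symm_apply_apply, map_neg] at h hxy hyx ⊢
    grind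
end

section
/- Let (A,·) be a finite-dimensional anti-pre-Lie algebra over a field k and B : A × A → k a nondegenerate skew-symmetric bilinear form such that B(x, y·z) − B(y, x·z) = B([y,x], z) for all x,y,z ∈ A, where [x,y] = x·y − y·x. Then there exist bilinear products ▷, ◁ : A × A → A satisfying B(x▷y, z) = −B(y, [z,x]) and B(x◁y, z) = B(y, z·x) for all x,y,z ∈ A, and (A,▷,◁) is an anti-L-dendriform algebra compatible with (A,·), i.e. x▷y − y◁x = x·y for all x,y ∈ A. -/
/-- On a finite-dimensional space, a bilinear map into endomorphisms can be transposed along a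
nondegenerate bilinear form. -/
theorem exists_transpose_of_nondegenerate {k A : Type*} [Field k] [AddCommGroup A] [Module k A]
    [FiniteDimensional k A] (B : A →ₗ[k] A →ₗ[k] k)
    (hnd : ∀ x : A, (∀ y : A, B x y = 0) → x = 0) (T : A →ₗ[k] A →ₗ[k] A) :
    ∃ S : A →ₗ[k] A →ₗ[k] A, ∀ x y z : A, B (S x y) z = B y (T x z) := by
  have hinj : Function.Injective B := by
    rw [injective_iff_map_eq_zero]
    exact fun x hx => hnd x fun y => by rw [hx, LinearMap.zero_apply]
  let e : A ≃ₗ[k] Module.Dual k A :=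
    B.linearEquivOfInjective hinj Subspace.dual_finrank_eq.symm
  have he : ∀ f : Module.Dual k A, B (e.symm f) = f :=
    fun f => e.apply_symm_apply f
  refine ⟨LinearMap.mk₂ k (fun x y => e.symm (B y ∘ₗ T x)) ?_ ?_ ?_ ?_, fun x y z => ?_⟩
  · intro x x' y
    rw [map_add, LinearMap.comp_add, map_add]
  · intro c x y
    rw [map_smul, LinearMap.comp_smul, map_smul]
  · intro x y y'
    rw [map_add, LinearMap.add_comp, map_add]
  · intro c x y
    rw [map_smul, LinearMap.smul_comp, map_smul]
  · rw [LinearMap.mk₂_apply, he, LinearMap.comp_apply]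

/-- A nondegenerate skew-symmetric invariant bilinear form on a finite-dimensional
anti-pre-Lie algebra gives a compatible anti-L-dendriform structure. -/
theorem stmt_17 {k A : Type*} [Field k] [AddCommGroup A] [Module k A]
    [FiniteDimensional k A]
    (mul : A →ₗ[k] A →ₗ[k] A) (hA : IsAntiPreLie k mul)
    (B : A →ₗ[k] A →ₗ[k] k)
    (hnd : ∀ x : A, (∀ y : A, B x y = 0) → x = 0)
    (hskew : ∀ x y : A, B x y = - B y x)
    (hinv : ∀ x y z : A, B x (mul y z) - B y (mul x z) = B (mul y x - mul x y) z) :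
    ∃ tr tl : A →ₗ[k] A →ₗ[k] A,
      (∀ x y z : A, B (tr x y) z = - B y (mul z x - mul x z)) ∧
      (∀ x y z : A, B (tl x y) z = B y (mul z x)) ∧
      IsAntiLDendriform k tr tl ∧
      (∀ x y : A, tr x y - tl y x = mul x y) := by
  obtain ⟨h1, h2⟩ := hA
  obtain ⟨tr, htr⟩ := exists_transpose_of_nondegenerate B hnd (mul - mul.flip)
  obtain ⟨tl, htl⟩ := exists_transpose_of_nondegenerate B hnd mul.flip
  simp only [LinearMap.sub_apply, LinearMap.flip_apply] at htr htl
  have hcompat : ∀ x y : A, tr x y - tl y x = mul x y := fun x y => by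
    refine sub_eq_zero.mp (hnd _ fun z => ?_)
    have h := hinv z x y
    simp only [map_sub, LinearMap.sub_apply, htr, htl] at h ⊢
    rw [hskew (mul x y) z]
    rw [hskew (mul x z) y, hskew (mul z x) y] at h
    linear_combination h
  -- the mixed left arguments in the axioms combine to products in `mul`
  have hcomm : ∀ x y z : A, tr (tr x y) z - tr (tl y x) z
      - tr (tr y x) z + tr (tl x y) z = tr (mul x y - mul y x) z := fun x y z => by
    rw [← hcompat x y, ← hcompat y x]
    simp only [map_sub, LinearMap.sub_apply]
    abel
  refine ⟨tr, tl, fun x y z => ?_, htl,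
    ⟨fun x y z => ?_, fun x y z => ?_, fun x y z => ?_⟩, hcompat⟩
  · rw [htr, ← map_neg, neg_sub]
  · have hc := hcomm x y z
    refine hnd _ fun w => ?_
    have a := congrArg (B z) (h1 x y w)
    have b := congrArg (B z) (h1 y w x)
    have c := congrArg (B z) (h1 w x y)
    have d := congrArg (B z) (h2 x y w)
    rw [show tr x (tr y z) - tr y (tr x z) - tr (tr y x) z + tr (tl x y) z
      + tr (tr x y) z - tr (tl y x) z = tr x (tr y z) - tr y (tr x z) +
        tr (mul x y - mul y x) z by rw [← hc]; abel]
    simp only [map_sub, map_add, map_zero, LinearMap.sub_apply, LinearMap.add_apply, htr]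
      at a b c d ⊢
    linear_combination 2 * d - a - b - c
  · refine hnd _ fun w => ?_
    have := congrArg (B z) (h1 x w y)
    have hc := congrArg (fun u => B (tl u z) w) (hcompat x y)
    simp only [map_sub, map_add, LinearMap.sub_apply, LinearMap.add_apply, htr, htl] at this hc ⊢
    linear_combination this - hc
  · have hc := hcomm x y z
    refine hnd _ fun w => ?_
    have a := congrArg (B z) (h1 x w y)
    have b := congrArg (B z) (h1 y w x)
    have d := congrArg (B z) (h2 x y w)
    have hc' := congrArg (fun u => B u w) hc
    simp only [map_sub, map_add, map_zero, LinearMap.sub_apply, LinearMap.add_apply, htr, htl]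
      at a b d hc' ⊢
    linear_combination a - b + d + hc'
end
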